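/- Let ζ ∈ B(ω,R) be a zero of f = (f₁,…,f_n) ∈ A²(ω,R)^n with Df(ζ) invertible; write γ = γ(f,ζ), κ = κ_ζ, and for x ∈ B(ω,R) set u = κ‖x − ζ‖. If u < 1, then ‖ Df(ζ)^{−1} ( Df(x)(x − ζ) − f(x) ) ‖ ≤ γ u² / (1 − u)². -/

import Mathlib

open MeasureTheory Metric

noncomputable section

/-- `ℂⁿ` with the Euclidean (Hermitian) norm. -/
abbrev En (n : ℕ) := EuclideanSpace ℂ (Fin n)

instance (n : ℕ) : InnerProductSpace ℝ (En n) := InnerProductSpace.rclikeToReal ℂ _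
instance (n : ℕ) : MeasurableSpace (En n) := borel _
instance (n : ℕ) : BorelSpace (En n) := ⟨rfl⟩

/-- The `A²(ω,R)` norm: `‖f‖² = (n!/(πⁿ R^{2n})) ∫_{B(ω,R)} ‖f(z)‖² dz`.  For a system
`f = (f₁,…,f_s) : ℂⁿ → ℂˢ` (with `ℂˢ` carrying the Euclidean norm) this is exactly
`(Σᵢ ‖fᵢ‖²)^{1/2}`. -/
def A2Norm {𝓕 : Type*} [NormedAddCommGroup 𝓕] {n : ℕ} (ω : En n) (R : ℝ)
    (f : En n → 𝓕) : ℝ :=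
  Real.sqrt (((n.factorial : ℝ) / (Real.pi ^ n * R ^ (2 * n))) * ∫ z in ball ω R, ‖f z‖ ^ 2)

/-- Membership in `A²(ω,R)`: analytic on the open ball `B(ω,R)` and square integrable there. -/
def MemA2 {𝓕 : Type*} [NormedAddCommGroup 𝓕] [NormedSpace ℂ 𝓕] {n : ℕ}
    (ω : En n) (R : ℝ) (f : En n → 𝓕) : Prop :=
  AnalyticOnNhd ℂ f (ball ω R) ∧ IntegrableOn (fun z => ‖f z‖ ^ 2) (ball ω R)

/-! ### Automorphisms of the unit ball -/

section BallAutomorphism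

variable {E : Type*} [NormedAddCommGroup E] [InnerProductSpace ℂ E]

/-- The automorphism of the unit ball that sends `0` to `ζ`. -/
def ballMap (ζ w : E) : E :=
  (1 + inner ℂ ζ w)⁻¹ • (ζ + ((√(1 - ‖ζ‖ ^ 2) : ℝ) : ℂ) • w +
    (inner ℂ ζ w / (1 + (√(1 - ‖ζ‖ ^ 2) : ℝ))) • ζ)

lemma norm_inner_lt_one {ζ w : E} (hζ : ‖ζ‖ < 1) (hw : ‖w‖ < 1) : ‖inner ℂ ζ w‖ < 1 :=
  (norm_inner_le_norm ζ w).trans_lt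
    (mul_lt_one_of_nonneg_of_lt_one_left (norm_nonneg _) hζ hw.le)

lemma one_add_ne_zero_of_norm_lt_one {z : ℂ} (hz : ‖z‖ < 1) : 1 + z ≠ 0 := by
  intro h
  rw [eq_neg_of_add_eq_zero_right h] at hz
  simp at hz

lemma one_sub_ne_zero_of_norm_lt_one {z : ℂ} (hz : ‖z‖ < 1) : 1 - z ≠ 0 := by
  rw [sub_eq_add_neg]
  exact one_add_ne_zero_of_norm_lt_one (by rwa [norm_neg])

lemma one_sub_norm_sq_pos {V : Type*} [SeminormedAddCommGroup V] {ζ : V} (hζ : ‖ζ‖ < 1) :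
    0 < 1 - ‖ζ‖ ^ 2 := by
  nlinarith [norm_nonneg ζ]

@[simp] lemma ballMap_zero (ζ : E) : ballMap ζ 0 = ζ := by simp [ballMap]

lemma one_add_sqrt_ne_zero (x : ℝ) : (1 + (√x : ℝ) : ℂ) ≠ 0 := by
  norm_cast
  positivity

lemma sq_sqrt_one_sub_norm_sq {V : Type*} [SeminormedAddCommGroup V] {ζ : V} (hζ : ‖ζ‖ < 1) :
    ((√(1 - ‖ζ‖ ^ 2) : ℝ) : ℂ) ^ 2 = 1 - (‖ζ‖ : ℂ) ^ 2 := by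
  norm_cast
  exact Real.sq_sqrt (one_sub_norm_sq_pos hζ).le

lemma inner_ballMap {ζ w : E} (hζ : ‖ζ‖ < 1) (hw : ‖w‖ < 1) :
    1 - inner ℂ ζ (ballMap ζ w) = (1 - ‖ζ‖ ^ 2 : ℝ) / (1 + inner ℂ ζ w) := by
  have hD := one_add_ne_zero_of_norm_lt_one (norm_inner_lt_one hζ hw)
  have hs := one_add_sqrt_ne_zero (1 - ‖ζ‖ ^ 2)
  have h2 := sq_sqrt_one_sub_norm_sq hζ
  simp only [ballMap, inner_add_right, inner_smul_right, inner_self_eq_norm_sq_to_K]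
  generalize ((√(1 - ‖ζ‖ ^ 2) : ℝ) : ℂ) = s at *
  generalize inner ℂ ζ w = q at *
  push_cast
  have h3 : (‖ζ‖ : ℂ) ^ 2 = 1 - s ^ 2 := by rw [h2]; ring
  simp only [Complex.coe_algebraMap, h3]
  field_simp
  ring

lemma ballMap_neg_ballMap {ζ w : E} (hζ : ‖ζ‖ < 1) (hw : ‖w‖ < 1) :
    ballMap (-ζ) (ballMap ζ w) = w := by
  have hD := one_add_ne_zero_of_norm_lt_one (norm_inner_lt_one hζ hw)
  have hs := one_add_sqrt_ne_zero (1 - ‖ζ‖ ^ 2)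
  have h2 := sq_sqrt_one_sub_norm_sq hζ
  have hS : ((1 - ‖ζ‖ ^ 2 : ℝ) : ℂ) ≠ 0 := by exact_mod_cast (one_sub_norm_sq_pos hζ).ne'
  have hi : inner ℂ ζ (ballMap ζ w) = 1 - (1 - ‖ζ‖ ^ 2 : ℝ) / (1 + inner ℂ ζ w) := by
    rw [← inner_ballMap hζ hw]; ring
  rw [ballMap]
  simp only [inner_neg_left, hi, norm_neg]
  rw [ballMap]
  push_cast at hS ⊢
  rw [← h2] at hS ⊢
  generalize ((√(1 - ‖ζ‖ ^ 2) : ℝ) : ℂ) = s at *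
  generalize inner ℂ ζ w = q at *
  have hs0 : s ≠ 0 := fun h => hS (by simp [h])
  have e : (1 + -(1 - s ^ 2 / (1 + q)))⁻¹ = (1 + q) / s ^ 2 := by
    field_simp
    ring
  rw [e]
  match_scalars
  · field_simp
    ring
  · field_simp

lemma norm_ballMap_lt_one {ζ w : E} (hζ : ‖ζ‖ < 1) (hw : ‖w‖ < 1) : ‖ballMap ζ w‖ < 1 := by
  have hD := one_add_ne_zero_of_norm_lt_one (norm_inner_lt_one hζ hw)
  have hs := one_add_sqrt_ne_zero (1 - ‖ζ‖ ^ 2)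
  have h2 := sq_sqrt_one_sub_norm_sq hζ
  have key : (1 - (‖ballMap ζ w‖ : ℂ) ^ 2) * ‖1 + inner ℂ ζ w‖ ^ 2 =
      (1 - (‖ζ‖ : ℂ) ^ 2) * (1 - (‖w‖ : ℂ) ^ 2) := by
    have e : (‖ballMap ζ w‖ : ℂ) ^ 2 = inner ℂ (ballMap ζ w) (ballMap ζ w) := by
      rw [inner_self_eq_norm_sq_to_K]; rfl
    have e2 : ((‖1 + inner ℂ ζ w‖ : ℝ) : ℂ) ^ 2 =
        (1 + inner ℂ ζ w) * (1 + (starRingEnd ℂ) (inner ℂ ζ w)) := by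
      rw [← Complex.mul_conj']; simp
    have hD' : 1 + (starRingEnd ℂ) (inner ℂ ζ w) ≠ 0 := by
      intro h
      apply hD
      apply (starRingEnd ℂ).injective
      simpa using h
    rw [e, e2]
    simp only [ballMap, inner_add_right, inner_smul_right, inner_add_left, inner_smul_left,
      ← inner_conj_symm w ζ, map_inv₀, map_add, map_one, map_div₀, Complex.conj_ofReal]
    simp only [inner_self_eq_norm_sq_to_K, Complex.coe_algebraMap]
    generalize ((√(1 - ‖ζ‖ ^ 2) : ℝ) : ℂ) = s at *
    generalize (starRingEnd ℂ) (inner ℂ ζ w) = q' at *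
    generalize inner ℂ ζ w = q at *
    have h3 : (‖ζ‖ : ℂ) ^ 2 = 1 - s ^ 2 := by rw [h2]; ring
    simp only [h3]
    field_simp
    ring
  have key' : (1 - ‖ballMap ζ w‖ ^ 2) * ‖1 + inner ℂ ζ w‖ ^ 2 =
      (1 - ‖ζ‖ ^ 2) * (1 - ‖w‖ ^ 2) := by exact_mod_cast key
  have hpos := mul_pos (one_sub_norm_sq_pos hζ) (one_sub_norm_sq_pos hw)
  rw [← key'] at hpos
  have := pos_of_mul_pos_left hpos (by positivity)
  nlinarith [norm_nonneg (ballMap ζ w)]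

lemma ballMap_image_ball {ζ : E} (hζ : ‖ζ‖ < 1) : ballMap ζ '' ball 0 1 = ball 0 1 := by
  ext y
  simp only [Set.mem_image, mem_ball_zero_iff]
  constructor
  · rintro ⟨w, hw, rfl⟩
    exact norm_ballMap_lt_one hζ hw
  · intro hy
    have hζ' : ‖-ζ‖ < 1 := by rwa [norm_neg]
    refine ⟨ballMap (-ζ) y, norm_ballMap_lt_one hζ' hy, ?_⟩
    simpa using ballMap_neg_ballMap hζ' hy

lemma ballMap_injOn {ζ : E} (hζ : ‖ζ‖ < 1) : Set.InjOn (ballMap ζ) (ball 0 1) := by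
  intro x hx y hy h
  rw [mem_ball_zero_iff] at hx hy
  rw [← ballMap_neg_ballMap hζ hx, h, ballMap_neg_ballMap hζ hy]

/-- The derivative of `ballMap ζ` at `w`. -/
def ballMapDeriv (ζ w : E) : E →L[ℂ] E :=
  (1 + inner ℂ ζ w)⁻¹ • ((√(1 - ‖ζ‖ ^ 2) : ℝ) : ℂ) • ContinuousLinearMap.id ℂ E +
    (innerSL ℂ ζ).smulRight ((1 + inner ℂ ζ w)⁻¹ •
      ((1 + (√(1 - ‖ζ‖ ^ 2) : ℝ) : ℂ)⁻¹ • ζ - ballMap ζ w))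

lemma hasFDerivAt_ballMap {ζ w : E} (hζ : ‖ζ‖ < 1) (hw : ‖w‖ < 1) :
    HasFDerivAt (ballMap ζ) (ballMapDeriv ζ w) w := by
  have hD := one_add_ne_zero_of_norm_lt_one (norm_inner_lt_one hζ hw)
  have hin : HasFDerivAt (fun w => inner ℂ ζ w) (innerSL ℂ ζ) w := (innerSL ℂ ζ).hasFDerivAt
  have h1 : HasFDerivAt (fun w => (1 + inner ℂ ζ w)⁻¹)
      (-((1 + inner ℂ ζ w) ^ 2)⁻¹ • innerSL ℂ ζ) w :=
    (hasDerivAt_inv hD).comp_hasFDerivAt w (hin.const_add 1)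
  have h2 := ((((hasFDerivAt_id w).const_smul ((√(1 - ‖ζ‖ ^ 2) : ℝ) : ℂ)).const_add ζ).add
    ((hin.mul_const (1 + (√(1 - ‖ζ‖ ^ 2) : ℝ) : ℂ)⁻¹).smul_const ζ))
  have h3 := h1.smul h2
  refine h3.congr_fderiv ?_
  ext v
  simp only [ballMapDeriv, ballMap, add_apply, smul_apply,
    ContinuousLinearMap.smulRight_apply, ContinuousLinearMap.id_apply, innerSL_apply_apply,
    Pi.add_apply, Pi.smul_apply, id]
  match_scalars
  · simp
  · simp
    field_simp
    ring
  · simp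
    field_simp

lemma det_ballMapDeriv [FiniteDimensional ℂ E] {ζ w : E} (hζ : ‖ζ‖ < 1) (hw : ‖w‖ < 1) :
    LinearMap.det (ballMapDeriv ζ w : E →ₗ[ℂ] E) =
      (((√(1 - ‖ζ‖ ^ 2) : ℝ) : ℂ) / (1 + inner ℂ ζ w)) ^ (Module.finrank ℂ E + 1) := by
  have hD := one_add_ne_zero_of_norm_lt_one (norm_inner_lt_one hζ hw)
  have hs := one_add_sqrt_ne_zero (1 - ‖ζ‖ ^ 2)
  have h2 := sq_sqrt_one_sub_norm_sq hζ
  have hs0 : ((√(1 - ‖ζ‖ ^ 2) : ℝ) : ℂ) ≠ 0 := by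
    exact_mod_cast (Real.sqrt_pos.2 (one_sub_norm_sq_pos hζ)).ne'
  have hi : inner ℂ ζ (ballMap ζ w) = 1 - (1 - ‖ζ‖ ^ 2 : ℝ) / (1 + inner ℂ ζ w) := by
    rw [← inner_ballMap hζ hw]; ring
  set s : ℂ := ((√(1 - ‖ζ‖ ^ 2) : ℝ) : ℂ) with hsdef
  have e : (ballMapDeriv ζ w : E →ₗ[ℂ] E) = (s / (1 + inner ℂ ζ w)) •
      LinearMap.transvection (innerSL ℂ ζ : E →ₗ[ℂ] ℂ)
        (s⁻¹ • ((1 + s)⁻¹ • ζ - ballMap ζ w)) := by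
    ext v
    simp only [ballMapDeriv, ← hsdef, ContinuousLinearMap.coe_coe, add_apply,
      smul_apply, ContinuousLinearMap.smulRight_apply,
      ContinuousLinearMap.id_apply, innerSL_apply_apply, LinearMap.smul_apply,
      LinearMap.transvection.apply]
    match_scalars <;> field_simp
  rw [e, LinearMap.det_smul, LinearMap.transvection.det, pow_succ]
  congr 1
  simp only [ContinuousLinearMap.coe_coe, innerSL_apply_apply, inner_smul_right, inner_sub_right,
    hi, inner_self_eq_norm_sq_to_K, Complex.coe_algebraMap]
  push_cast
  have h3 : (‖ζ‖ : ℂ) ^ 2 = 1 - s ^ 2 := by rw [h2]; ring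
  simp only [h3]
  field_simp
  ring

lemma abs_det_restrictScalars [FiniteDimensional ℂ E] (L : E →L[ℂ] E) :
    |(L.restrictScalars ℝ).det| = ‖LinearMap.det (L : E →ₗ[ℂ] E)‖ ^ 2 := by
  have : ((L.restrictScalars ℝ : E →L[ℝ] E) : E →ₗ[ℝ] E) = (L : E →ₗ[ℂ] E).restrictScalars ℝ := rfl
  rw [ContinuousLinearMap.det, this, LinearMap.det_restrictScalars, Algebra.norm_complex_apply,
    Complex.normSq_eq_norm_sq, abs_of_nonneg (by positivity)]

end BallAutomorphism

/-! ### Mean value property and reproducing formula on the unit ball -/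

section Reproducing

variable {E : Type*} [NormedAddCommGroup E] [InnerProductSpace ℂ E]

lemma one_sub_inner_ne_zero {z w : E} (hz : ‖z‖ < 1) (hw : ‖w‖ < 1) : 1 - inner ℂ w z ≠ 0 :=
  one_sub_ne_zero_of_norm_lt_one (norm_inner_lt_one hw hz)

lemma one_sub_norm_le_norm_one_sub_inner (z : E) {w : E} (hw : ‖w‖ < 1) :
    1 - ‖z‖ ≤ ‖1 - inner ℂ w z‖ := by
  have h1 := norm_sub_norm_le (1 : ℂ) (inner ℂ w z)
  have h2 := norm_inner_le_norm (𝕜 := ℂ) w z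
  rw [norm_one] at h1
  nlinarith [norm_nonneg z]

/-- The Bergman kernel of the unit ball, for normalized Lebesgue measure. -/
def bergmanKernel (z w : E) : ℂ := ((1 - inner ℂ w z) ^ (Module.finrank ℂ E + 1))⁻¹

lemma norm_bergmanKernel_le {z w : E} (hz : ‖z‖ < 1) (hw : ‖w‖ < 1) :
    ‖bergmanKernel z w‖ ≤ ((1 - ‖z‖) ^ (Module.finrank ℂ E + 1))⁻¹ := by
  rw [bergmanKernel, norm_inv, norm_pow]
  have : 0 < 1 - ‖z‖ := by linarith
  gcongr
  exact one_sub_norm_le_norm_one_sub_inner z hw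

lemma continuousOn_bergmanKernel {z : E} (hz : ‖z‖ < 1) :
    ContinuousOn (bergmanKernel z) (ball 0 1) := by
  refine ContinuousOn.inv₀ (by fun_prop) ?_
  intro w hw
  exact pow_ne_zero _ (one_sub_inner_ne_zero hz (by simpa using hw))

variable [MeasurableSpace E] [BorelSpace E]

lemma measurableEmbedding_const_smul_of_norm_eq_one {c : ℂ} (hc : ‖c‖ = 1) :
    MeasurableEmbedding (fun w : E => c • w) :=
  (Homeomorph.smulOfNeZero c (by rintro rfl; simp at hc)).measurableEmbedding

variable {μ : Measure E} {F : Type*} [NormedAddCommGroup F] [NormedSpace ℂ F]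

lemma integrableOn_bergmanKernel_smul {g : E → F} {z : E} (hz : ‖z‖ < 1)
    (hgi : IntegrableOn g (ball 0 1) μ) :
    IntegrableOn (fun w => bergmanKernel z w • g w) (ball 0 1) μ := by
  refine Integrable.bdd_smul hgi (((1 - ‖z‖) ^ (Module.finrank ℂ E + 1))⁻¹)
    ((continuousOn_bergmanKernel hz).aestronglyMeasurable measurableSet_ball) ?_
  filter_upwards [ae_restrict_mem measurableSet_ball] with w hw
  exact norm_bergmanKernel_le hz (by simpa using hw)

variable [FiniteDimensional ℂ E] [μ.IsAddHaarMeasure]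

lemma measurePreserving_smul_ball {c : ℂ} (hc : ‖c‖ = 1) :
    MeasurePreserving (fun w : E => c • w) (μ.restrict (ball 0 1)) (μ.restrict (ball 0 1)) := by
  have hc0 : c ≠ 0 := by rintro rfl; simp at hc
  have h1 : MeasurePreserving (fun w : E => c • w) μ μ := by
    refine ⟨(continuous_const_smul c).measurable, ?_⟩
    have hdet := abs_det_restrictScalars (c • ContinuousLinearMap.id ℂ E)
    have h2 : ((c • ContinuousLinearMap.id ℂ E : E →L[ℂ] E) : E →ₗ[ℂ] E) =
      c • LinearMap.id := rfl
    rw [h2, LinearMap.det_smul, LinearMap.det_id, mul_one, norm_pow, hc, one_pow, one_pow] at hdet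
    have h3 := Measure.map_linearMap_addHaar_eq_smul_addHaar μ
      (f := ((c • ContinuousLinearMap.id ℂ E).restrictScalars ℝ : E →L[ℝ] E)) (by
        intro h
        rw [ContinuousLinearMap.det, h] at hdet
        simp at hdet)
    rw [ContinuousLinearMap.det] at hdet
    rw [abs_inv, hdet] at h3
    simpa [Function.comp_def, ContinuousLinearMap.coe_restrictScalars'] using! h3
  have h4 := h1.restrict_preimage (s := ball (0 : E) 1) measurableSet_ball
  have h5 : (fun w : E => c • w) ⁻¹' ball 0 1 = ball 0 1 := by
    ext w
    simp [norm_smul, hc]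
  rwa [h5] at h4

variable [CompleteSpace F]

/-- Mean value property of holomorphic functions on the unit ball. -/
lemma setIntegral_ball_eq_smul_of_differentiableOn {g : E → F}
    (hg : DifferentiableOn ℂ g (ball 0 1)) (hgi : IntegrableOn g (ball 0 1) μ) :
    ∫ w in ball 0 1, g w ∂μ = μ.real (ball (0 : E) 1) • g 0 := by
  have : IsFiniteMeasure (μ.restrict (ball (0 : E) 1)) :=
    ⟨by simpa using measure_ball_lt_top⟩
  have : IsFiniteMeasure (volume.restrict (Set.uIoc 0 (2 * Real.pi))) := by
    rw [Set.uIoc]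
    infer_instance
  have hnorm : ∀ θ : ℝ, ‖circleMap 0 1 θ‖ = 1 := fun θ => by simp
  have hrot (θ : ℝ) : ∫ w in ball 0 1, g (circleMap 0 1 θ • w) ∂μ = ∫ w in ball 0 1, g w ∂μ :=
    (measurePreserving_smul_ball (hnorm θ)).integral_comp
      (measurableEmbedding_const_smul_of_norm_eq_one (hnorm θ)) g
  have hint : Integrable (Function.uncurry fun (θ : ℝ) (w : E) => g (circleMap 0 1 θ • w))
      ((volume.restrict (Set.uIoc 0 (2 * Real.pi))).prod (μ.restrict (ball 0 1))) := by
    rw [integrable_prod_iff]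
    · constructor
      · refine Filter.Eventually.of_forall fun θ => ?_
        exact ((measurePreserving_smul_ball (hnorm θ)).integrable_comp_emb
          (measurableEmbedding_const_smul_of_norm_eq_one (hnorm θ))).2 hgi
      · have : ∀ θ : ℝ, ∫ w in ball 0 1, ‖g (circleMap 0 1 θ • w)‖ ∂μ =
            ∫ w in ball 0 1, ‖g w‖ ∂μ := fun θ =>
          (measurePreserving_smul_ball (hnorm θ)).integral_comp
            (measurableEmbedding_const_smul_of_norm_eq_one (hnorm θ)) fun w => ‖g w‖
        simp only [Function.uncurry, this]
        exact integrable_const _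
    · rw [Measure.prod_restrict]
      refine ContinuousOn.aestronglyMeasurable ?_ (measurableSet_uIoc.prod measurableSet_ball)
      refine hg.continuousOn.comp (f := fun p : ℝ × E => circleMap 0 1 p.1 • p.2)
        (by fun_prop) ?_
      rintro ⟨θ, w⟩ ⟨-, hw⟩
      simpa [norm_smul] using hw
  have hswap := intervalIntegral_integral_swap hint
  simp only [hrot] at hswap
  rw [intervalIntegral.integral_const] at hswap
  have hcirc : ∀ w ∈ ball (0 : E) 1,
      ∫ θ in (0 : ℝ)..2 * Real.pi, g (circleMap 0 1 θ • w) = (2 * Real.pi) • g 0 := by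
    intro w hw
    rw [mem_ball_zero_iff] at hw
    have hd : DiffContOnCl ℂ (fun t : ℂ => g (t • w)) (ball 0 |1|) := by
      refine DifferentiableOn.diffContOnCl ?_
      refine hg.comp (f := fun t : ℂ => t • w) (by fun_prop) ?_
      intro t ht
      rw [abs_one, closure_ball _ one_ne_zero, mem_closedBall_zero_iff] at ht
      rw [mem_ball_zero_iff, norm_smul]
      nlinarith [norm_nonneg w]
    have h1 := hd.circleAverage
    rw [Real.circleAverage_def, zero_smul] at h1
    rw [← h1, smul_smul, mul_inv_cancel₀ (by positivity), one_smul]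
  rw [setIntegral_congr_fun measurableSet_ball hcirc, setIntegral_const, sub_zero,
    smul_comm] at hswap
  exact smul_right_injective F (by positivity : (2 * Real.pi) ≠ 0) hswap

/-- Reproducing formula of the Bergman kernel of the unit ball. -/
theorem setIntegral_bergmanKernel_smul {g : E → F} {z : E} (hz : ‖z‖ < 1)
    (hg : DifferentiableOn ℂ g (ball 0 1)) (hgi : IntegrableOn g (ball 0 1) μ) :
    ∫ w in ball 0 1, bergmanKernel z w • g w ∂μ = μ.real (ball (0 : E) 1) • g z := by
  have hderiv : ∀ w ∈ ball (0 : E) 1, HasFDerivWithinAt (ballMap z)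
      ((ballMapDeriv z w).restrictScalars ℝ) (ball 0 1) w := fun w hw =>
    ((hasFDerivAt_ballMap hz (by simpa using hw)).restrictScalars ℝ).hasFDerivWithinAt
  have htrans : ∀ w ∈ ball (0 : E) 1,
      |((ballMapDeriv z w).restrictScalars ℝ).det| •
        (bergmanKernel z (ballMap z w) • g (ballMap z w)) =
      ((1 + inner ℂ z w) ^ (Module.finrank ℂ E + 1))⁻¹ • g (ballMap z w) := by
    intro w hw
    rw [mem_ball_zero_iff] at hw
    have hD := one_add_ne_zero_of_norm_lt_one (norm_inner_lt_one hz hw)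
    have hS : ((1 - ‖z‖ ^ 2 : ℝ) : ℂ) ≠ 0 := by exact_mod_cast (one_sub_norm_sq_pos hz).ne'
    have hD' : (starRingEnd ℂ) (1 + inner ℂ z w) ≠ 0 := by
      rwa [map_ne_zero]
    have h1 : 1 - inner ℂ (ballMap z w) z =
        (1 - ‖z‖ ^ 2 : ℝ) / (starRingEnd ℂ) (1 + inner ℂ z w) := by
      rw [← inner_conj_symm, ← map_one (starRingEnd ℂ), ← map_sub, inner_ballMap hz hw, map_div₀,
        Complex.conj_ofReal, map_one]
    rw [abs_det_restrictScalars, det_ballMapDeriv hz hw, bergmanKernel, h1,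
      ← Complex.coe_smul, smul_smul]
    congr 1
    rw [← norm_pow, ← pow_mul, mul_comm (Module.finrank ℂ E + 1), pow_mul, norm_pow, div_pow,
      sq_sqrt_one_sub_norm_sq hz, norm_div]
    rw [norm_pow, Complex.ofReal_pow, Complex.ofReal_div, Complex.ofReal_pow, ← Complex.mul_conj',
      ← inv_pow, ← mul_pow, ← inv_pow]
    have : ((‖1 - (‖z‖ : ℂ) ^ 2‖ : ℝ) : ℂ) = ((1 - ‖z‖ ^ 2 : ℝ) : ℂ) := by
      rw [← Complex.ofReal_pow, ← Complex.ofReal_one, ← Complex.ofReal_sub, Complex.norm_real,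
        Real.norm_of_nonneg (one_sub_norm_sq_pos hz).le]
    rw [this]
    congr 1
    field_simp
  have hint := (integrableOn_image_iff_integrableOn_abs_det_fderiv_smul μ measurableSet_ball
    hderiv (ballMap_injOn hz) fun w => bergmanKernel z w • g w).1
    (by rw [ballMap_image_ball hz]; exact integrableOn_bergmanKernel_smul hz hgi)
  rw [integrableOn_congr_fun htrans measurableSet_ball] at hint
  have h := integral_image_eq_integral_abs_det_fderiv_smul μ measurableSet_ball hderiv
    (ballMap_injOn hz) fun w => bergmanKernel z w • g w
  rw [ballMap_image_ball hz, setIntegral_congr_fun measurableSet_ball htrans,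
    setIntegral_ball_eq_smul_of_differentiableOn ?_ hint] at h
  · simpa using h
  · intro w hw
    have hw' : ‖w‖ < 1 := by simpa using hw
    have hin : DifferentiableAt ℂ (fun w => inner ℂ z w) w := (innerSL ℂ z).differentiableAt
    have hgz : DifferentiableAt ℂ g (ballMap z w) :=
      hg.differentiableAt (isOpen_ball.mem_nhds (by simpa using norm_ballMap_lt_one hz hw'))
    have h2 : DifferentiableAt ℂ (fun w => ((1 + inner ℂ z w) ^ (Module.finrank ℂ E + 1))⁻¹) w :=
      ((hin.const_add 1).pow _).inv
        (pow_ne_zero _ (one_add_ne_zero_of_norm_lt_one (norm_inner_lt_one hz hw')))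
    exact (h2.smul (hgz.comp w (hasFDerivAt_ballMap hz hw').differentiableAt)).differentiableWithinAt

end Reproducing

/-! ### Taylor coefficients along complex lines -/

lemma factorial_add_two_mul_le {n k : ℕ} (hn : 2 ≤ n) (hk : 2 ≤ k) (hnk : ¬(n = 2 ∧ k = 2)) :
    (n + 2 * k).factorial ≤ (n + 1) ^ (2 * k) * (n.factorial * k.factorial ^ 2) := by
  have step : ∀ k, 1 ≤ k →
      (n + 2 * k).factorial ≤ (n + 1) ^ (2 * k) * (n.factorial * k.factorial ^ 2) →
      (n + 2 * (k + 1)).factorial ≤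
        (n + 1) ^ (2 * (k + 1)) * (n.factorial * (k + 1).factorial ^ 2) := by
    intro k hk1 ih
    have h1 : n + 2 * k + 2 ≤ (k + 1) * (n + 1) := by nlinarith
    have h2 : (n + 2 * k + 2) * (n + 2 * k + 1) ≤ ((k + 1) * (n + 1)) ^ 2 := by
      rw [sq]
      exact Nat.mul_le_mul h1 (by lia)
    calc (n + 2 * (k + 1)).factorial
        = ((n + 2 * k + 2) * (n + 2 * k + 1)) * (n + 2 * k).factorial := by
          rw [show n + 2 * (k + 1) = n + 2 * k + 1 + 1 by ring, Nat.factorial_succ,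
            Nat.factorial_succ]
          ring
      _ ≤ ((k + 1) * (n + 1)) ^ 2 *
          ((n + 1) ^ (2 * k) * (n.factorial * k.factorial ^ 2)) := Nat.mul_le_mul h2 ih
      _ = _ := by
          rw [Nat.factorial_succ]
          ring
  rcases Nat.lt_or_ge 2 n with h3 | h3
  · induction k, hk using Nat.le_induction with
    | base =>
      obtain ⟨m, rfl⟩ := Nat.exists_eq_add_of_le' h3
      rw [show m + (2 + 1) + 2 * 2 = m + 6 + 1 by ring]
      simp only [Nat.factorial_succ]
      norm_num
      have : (m + 6 + 1) * (m + 5 + 1) * (m + 4 + 1) ≤ 4 * (m + 3 + 1) ^ 3 := by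
        nlinarith [Nat.zero_le (m ^ 3), Nat.zero_le (m ^ 2)]
      calc _ = (m + 6 + 1) * (m + 5 + 1) * (m + 4 + 1) *
            ((m + 3 + 1) * ((m + 2 + 1) * ((m + 1 + 1) * ((m + 1) * m.factorial)))) := by ring
        _ ≤ 4 * (m + 3 + 1) ^ 3 *
            ((m + 3 + 1) * ((m + 2 + 1) * ((m + 1 + 1) * ((m + 1) * m.factorial)))) := by gcongr
        _ = _ := by ring
    | succ k hk ih => exact step k (by lia) (ih (by lia))
  · obtain rfl : n = 2 := by lia
    have hk3 : 3 ≤ k := by lia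
    clear hk hnk
    induction k, hk3 using Nat.le_induction with
    | base => decide
    | succ k hk ih => exact step k (by lia) ih

lemma choose_mul_choose_le {n k : ℕ} (hn : 2 ≤ n) (hk : 2 ≤ k) (hnk : ¬(n = 2 ∧ k = 2)) :
    (k + n).choose n * (k + (n + k)).choose (n + k) ≤ (n + 1) ^ (2 * k) := by
  have h1 := Nat.add_choose_mul_factorial_mul_factorial k n
  have h2 := Nat.add_choose_mul_factorial_mul_factorial k (n + k)
  have h3 := factorial_add_two_mul_le hn hk hnk
  rw [show k + (n + k) = n + 2 * k by ring] at h2 ⊢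
  rw [add_comm n k] at *
  have hpos : 0 < n.factorial * k.factorial ^ 2 := by positivity
  refine Nat.le_of_mul_le_mul_right (le_trans (le_of_eq ?_) h3) hpos
  rw [← h2, ← h1]
  ring

lemma choose_mul_sum_sub_le {n k : ℕ} (hn : 2 ≤ n) (hk : 2 ≤ k) {X Y b : ℝ} (hX : 0 ≤ X)
    (hY : 0 ≤ Y) (hXY : X + Y ≤ b) :
    ((k + n).choose n : ℝ) * ∑ p ∈ Finset.HasAntidiagonal.antidiagonal k,
        (k.choose p.1 : ℝ) * ((p.2 + (n + k)).choose (n + k)) * (X ^ p.1 * Y ^ p.2) -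
      ((k + n).choose n : ℝ) ^ 2 * Y ^ k ≤ (((n : ℝ) + 1) ^ k) ^ 2 * b ^ k := by
  by_cases h : n = 2 ∧ k = 2
  · obtain ⟨rfl, rfl⟩ := h
    have e : Finset.HasAntidiagonal.antidiagonal 2 = {(0, 2), (1, 1), (2, 0)} := rfl
    have c1 : Nat.choose 4 2 = 6 := rfl
    have c2 : Nat.choose 6 4 = 15 := rfl
    simp [e, c1, c2]
    nlinarith [mul_nonneg hX hY, sq_nonneg X, sq_nonneg Y, pow_le_pow_left₀ (add_nonneg hX hY) hXY 2]
  · have h1 : ∑ p ∈ Finset.HasAntidiagonal.antidiagonal k,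
        (k.choose p.1 : ℝ) * ((p.2 + (n + k)).choose (n + k)) * (X ^ p.1 * Y ^ p.2) ≤
        ((k + (n + k)).choose (n + k)) * (X + Y) ^ k := by
      rw [(Commute.all X Y).add_pow', Finset.mul_sum]
      refine Finset.sum_le_sum fun p hp => ?_
      have hp2 : p.2 ≤ k := Finset.HasAntidiagonal.antidiagonal.snd_le hp
      rw [nsmul_eq_mul, mul_comm (k.choose p.1 : ℝ), mul_assoc]
      gcongr
    have h2 : (((k + n).choose n * (k + (n + k)).choose (n + k) : ℕ) : ℝ) ≤
        ((n + 1) ^ (2 * k) : ℕ) := by exact_mod_cast choose_mul_choose_le hn hk h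
    push_cast at h2
    calc _ ≤ ((k + n).choose n : ℝ) * (((k + (n + k)).choose (n + k)) * (X + Y) ^ k) := by
          have : 0 ≤ ((k + n).choose n : ℝ) ^ 2 * Y ^ k := by positivity
          have := mul_le_mul_of_nonneg_left h1 (Nat.cast_nonneg (α := ℝ) ((k + n).choose n))
          linarith
      _ ≤ ((n : ℝ) + 1) ^ (2 * k) * b ^ k := by
          rw [← mul_assoc]
          gcongr
      _ = _ := by rw [← pow_mul, mul_comm 2]

/-- Uniqueness of power series coefficients. -/
lemma eq_of_eventually_hasSum_pow_smul {F : Type*} [NormedAddCommGroup F] [NormedSpace ℂ F]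
    {p q : ℕ → F} {h : ℂ → F} (hp : ∀ᶠ t in nhds 0, HasSum (fun k => t ^ k • p k) (h t))
    (hq : ∀ᶠ t in nhds 0, HasSum (fun k => t ^ k • q k) (h t)) : p = q := by
  have key (r : ℕ → F) (hr : ∀ᶠ t in nhds 0, HasSum (fun k => t ^ k • r k) (h t)) :
      HasFPowerSeriesAt h (fun k => ContinuousMultilinearMap.mkPiRing ℂ (Fin k) (r k)) 0 := by
    refine hasFPowerSeriesAt_iff.2 ?_
    simpa [FormalMultilinearSeries.coeff] using hr
  have h1 := (key p hp).eq_formalMultilinearSeries (key q hq)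
  ext k
  have h2 := congrFun h1 k
  simpa using congrArg (fun L => L fun _ => 1) h2

/-- Taylor expansion of `(a + t b) ^ k / (S - t β) ^ (l + 1)`. -/
lemma hasSum_add_pow_mul_inv_sub_pow {a b S β t : ℂ} (k l : ℕ) (hS : S ≠ 0)
    (ht : ‖t * β / S‖ < 1) :
    HasSum (fun j => t ^ j * ∑ p ∈ Finset.HasAntidiagonal.antidiagonal j,
        ((k.choose p.1 : ℂ) * ((p.2 + l).choose l) * (b ^ p.1 * a ^ (k - p.1)) *
          (β ^ p.2 / S ^ (l + 1 + p.2))))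
      ((a + t * b) ^ k * ((S - t * β) ^ (l + 1))⁻¹) := by
  have h1 : HasSum (fun x => t ^ x * ((k.choose x : ℂ) * (b ^ x * a ^ (k - x))))
      ((a + t * b) ^ k) := by
    rw [add_comm, add_pow]
    have : ∀ x ∉ Finset.range (k + 1), t ^ x * ((k.choose x : ℂ) * (b ^ x * a ^ (k - x))) = 0 := by
      intro x hx
      rw [Nat.choose_eq_zero_of_lt (by simpa using hx)]
      simp
    have h := hasSum_sum_of_ne_finset_zero (L := .unconditional ℕ) this
    have e := Finset.sum_congr rfl fun x (_ : x ∈ Finset.range (k + 1)) => (show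
      t ^ x * ((k.choose x : ℂ) * (b ^ x * a ^ (k - x))) =
        (t * b) ^ x * a ^ (k - x) * (k.choose x : ℂ) by ring)
    rwa [e] at h
  have h1s : Summable fun x => ‖t ^ x * ((k.choose x : ℂ) * (b ^ x * a ^ (k - x)))‖ := by
    refine summable_of_ne_finset_zero (s := Finset.range (k + 1)) fun x hx => ?_
    rw [Nat.choose_eq_zero_of_lt (by simpa using hx)]
    simp
  have h2 : HasSum (fun y => t ^ y * (((y + l).choose l : ℂ) * (β ^ y / S ^ (l + 1 + y))))
      ((S - t * β) ^ (l + 1))⁻¹ := by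
    have h := (hasSum_choose_mul_geometric_of_norm_lt_one l ht).mul_left (S ^ (l + 1))⁻¹
    have e : (S ^ (l + 1))⁻¹ * (1 / (1 - t * β / S) ^ (l + 1)) = ((S - t * β) ^ (l + 1))⁻¹ := by
      rw [one_div, ← mul_inv, ← mul_pow]
      congr 2
      field_simp
    rw [e] at h
    refine h.congr_fun ?_
    intro y
    rw [div_pow, mul_pow, pow_add S (l + 1) y]
    field_simp
  have h2s : Summable fun y =>
      ‖t ^ y * (((y + l).choose l : ℂ) * (β ^ y / S ^ (l + 1 + y)))‖ := h2.summable.norm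
  have h3 := (summable_norm_sum_mul_antidiagonal_of_summable_norm h1s h2s).of_norm.hasSum
  rw [← tsum_mul_tsum_eq_tsum_sum_antidiagonal_of_summable_norm h1s h2s, h1.tsum_eq,
    h2.tsum_eq] at h3
  refine h3.congr_fun fun j => ?_
  rw [Finset.mul_sum]
  refine Finset.sum_congr rfl fun p hp => ?_
  rw [← Finset.HasAntidiagonal.mem_antidiagonal.1 hp, pow_add]
  ring

section Taylor

variable {E : Type*} [NormedAddCommGroup E] [InnerProductSpace ℂ E]

/-- Coefficient of `t ^ k` in the expansion of `bergmanKernel (ζ + t • v) w`. -/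
def bergmanCoeff (ζ v : E) (k : ℕ) (w : E) : ℂ :=
  ((k + Module.finrank ℂ E).choose (Module.finrank ℂ E) : ℂ) * inner ℂ w v ^ k *
    ((1 - inner ℂ w ζ) ^ (Module.finrank ℂ E + 1 + k))⁻¹

lemma bergmanCoeff_zero (ζ v : E) : bergmanCoeff ζ v 0 = bergmanKernel ζ := by
  ext w
  simp [bergmanCoeff, bergmanKernel]

lemma hasSum_bergmanCoeff {ζ v w : E} (hζ : ‖ζ‖ < 1) (hw : ‖w‖ < 1) {t : ℂ}
    (ht : ‖t‖ * ‖v‖ < 1 - ‖ζ‖) :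
    HasSum (fun k => t ^ k * bergmanCoeff ζ v k w) (bergmanKernel (ζ + t • v) w) := by
  have h0 := one_sub_inner_ne_zero hζ hw
  have h1 : ‖t * inner ℂ w v / (1 - inner ℂ w ζ)‖ < 1 := by
    rw [norm_div, norm_mul, div_lt_one (norm_pos_iff.2 h0)]
    have h2 : ‖inner ℂ w v‖ ≤ ‖v‖ :=
      (norm_inner_le_norm w v).trans (mul_le_of_le_one_left (norm_nonneg v) hw.le)
    calc ‖t‖ * ‖inner ℂ w v‖ ≤ ‖t‖ * ‖v‖ := by gcongr
      _ < 1 - ‖ζ‖ := ht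
      _ ≤ _ := one_sub_norm_le_norm_one_sub_inner ζ hw
  have h := (hasSum_choose_mul_geometric_of_norm_lt_one (Module.finrank ℂ E) h1).mul_left
    ((1 - inner ℂ w ζ) ^ (Module.finrank ℂ E + 1))⁻¹
  have e : ((1 - inner ℂ w ζ) ^ (Module.finrank ℂ E + 1))⁻¹ *
      (1 / (1 - t * inner ℂ w v / (1 - inner ℂ w ζ)) ^ (Module.finrank ℂ E + 1)) =
      bergmanKernel (ζ + t • v) w := by
    rw [bergmanKernel, one_div, ← mul_inv, ← mul_pow, inner_add_right, inner_smul_right]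
    congr 2
    field_simp
    ring
  rw [e] at h
  refine h.congr_fun fun k => ?_
  rw [bergmanCoeff, div_pow, mul_pow, pow_add _ (Module.finrank ℂ E + 1) k]
  field_simp

lemma norm_bergmanCoeff_le {ζ w : E} (v : E) (hζ : ‖ζ‖ < 1) (hw : ‖w‖ < 1) (k : ℕ) :
    ‖bergmanCoeff ζ v k w‖ ≤ ((1 - ‖ζ‖) ^ (Module.finrank ℂ E + 1))⁻¹ *
      (((k + Module.finrank ℂ E).choose (Module.finrank ℂ E) : ℝ) * (‖v‖ / (1 - ‖ζ‖)) ^ k) := by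
  have h0 : 0 < 1 - ‖ζ‖ := by linarith
  have h2 : ‖inner ℂ w v‖ ≤ ‖v‖ :=
    (norm_inner_le_norm w v).trans (mul_le_of_le_one_left (norm_nonneg v) hw.le)
  rw [bergmanCoeff, norm_mul, norm_mul, norm_inv, norm_pow, norm_pow, Complex.norm_natCast]
  calc _ ≤ ((k + Module.finrank ℂ E).choose (Module.finrank ℂ E) : ℝ) * ‖v‖ ^ k *
        ((1 - ‖ζ‖) ^ (Module.finrank ℂ E + 1 + k))⁻¹ := by
        gcongr
        exact one_sub_norm_le_norm_one_sub_inner ζ hw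
    _ = _ := by
        rw [pow_add _ (Module.finrank ℂ E + 1) k, div_pow]
        field_simp

lemma continuousOn_bergmanCoeff {ζ : E} (v : E) (hζ : ‖ζ‖ < 1) (k : ℕ) :
    ContinuousOn (bergmanCoeff ζ v k) (ball 0 1) := by
  refine ContinuousOn.mul (by fun_prop) (ContinuousOn.inv₀ (by fun_prop) ?_)
  intro w hw
  exact pow_ne_zero _ (one_sub_inner_ne_zero hζ (by simpa using hw))

lemma differentiableOn_conj_bergmanCoeff {ζ : E} (v : E) (hζ : ‖ζ‖ < 1) (k : ℕ) :
    DifferentiableOn ℂ (fun w => (starRingEnd ℂ) (bergmanCoeff ζ v k w)) (ball 0 1) := by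
  simp only [bergmanCoeff, map_mul, map_pow, map_inv₀, map_sub, map_one, inner_conj_symm]
  have hin (z : E) : Differentiable ℂ (fun w => inner ℂ z w) := (innerSL ℂ z).differentiable
  refine ((((hin v).pow k).const_mul _).differentiableOn).mul ?_
  refine (((hin ζ).const_sub 1).pow _).differentiableOn.inv fun w hw => ?_
  exact pow_ne_zero _ (one_sub_inner_ne_zero (by simpa using hw) hζ)

variable [MeasurableSpace E] [BorelSpace E] {μ : Measure E}
  {F : Type*} [NormedAddCommGroup F] [NormedSpace ℂ F]

lemma integrableOn_bergmanCoeff_smul {g : E → F} {ζ : E} (v : E) (hζ : ‖ζ‖ < 1) (k : ℕ)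
    (hgi : IntegrableOn g (ball 0 1) μ) :
    IntegrableOn (fun w => bergmanCoeff ζ v k w • g w) (ball 0 1) μ := by
  refine Integrable.bdd_smul hgi (((1 - ‖ζ‖) ^ (Module.finrank ℂ E + 1))⁻¹ *
      (((k + Module.finrank ℂ E).choose (Module.finrank ℂ E) : ℝ) * (‖v‖ / (1 - ‖ζ‖)) ^ k))
    ((continuousOn_bergmanCoeff v hζ k).aestronglyMeasurable measurableSet_ball) ?_
  filter_upwards [ae_restrict_mem measurableSet_ball] with w hw
  exact norm_bergmanCoeff_le v hζ (by simpa using hw) k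

variable [FiniteDimensional ℂ E] [μ.IsAddHaarMeasure]

lemma integrableOn_conj_bergmanCoeff {ζ : E} (v : E) (hζ : ‖ζ‖ < 1) (k : ℕ) :
    IntegrableOn (fun w => (starRingEnd ℂ) (bergmanCoeff ζ v k w)) (ball 0 1) μ := by
  have h1 : IntegrableOn (fun _ : E => (1 : ℂ)) (ball 0 1) μ :=
    integrableOn_const measure_ball_lt_top.ne
  have h2 := integrableOn_bergmanCoeff_smul v hζ k h1
  simp only [smul_eq_mul, mul_one] at h2
  refine Integrable.mono h2 ((differentiableOn_conj_bergmanCoeff v hζ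
    k).continuousOn.aestronglyMeasurable measurableSet_ball) ?_
  simp

variable [CompleteSpace F]

/-- Taylor expansion of a holomorphic function along a complex line, with coefficients given by
integrals against the derivatives of the Bergman kernel. -/
theorem hasSum_setIntegral_bergmanCoeff_smul {g : E → F} {ζ : E} (v : E) (hζ : ‖ζ‖ < 1)
    (hg : DifferentiableOn ℂ g (ball 0 1)) (hgi : IntegrableOn g (ball 0 1) μ) {t : ℂ}
    (ht : ‖t‖ * ‖v‖ < 1 - ‖ζ‖) :
    HasSum (fun k => t ^ k • ∫ w in ball 0 1, bergmanCoeff ζ v k w • g w ∂μ)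
      (μ.real (ball (0 : E) 1) • g (ζ + t • v)) := by
  have h0 : 0 < 1 - ‖ζ‖ := by linarith
  have hz : ‖ζ + t • v‖ < 1 := by
    refine (norm_add_le _ _).trans_lt ?_
    rw [norm_smul]
    linarith
  have hint (k : ℕ) : Integrable (fun w => t ^ k • bergmanCoeff ζ v k w • g w)
      (μ.restrict (ball 0 1)) := (integrableOn_bergmanCoeff_smul v hζ k hgi).smul _
  have hρ : ‖‖t‖ * ‖v‖ / (1 - ‖ζ‖)‖ < 1 := by
    rw [Real.norm_of_nonneg (by positivity), div_lt_one h0]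
    exact ht
  have hsum : Summable fun k => ∫ w in ball 0 1, ‖t ^ k • bergmanCoeff ζ v k w • g w‖ ∂μ := by
    refine Summable.of_nonneg_of_le (fun k => integral_nonneg fun w => norm_nonneg _) (fun k => ?_)
      ((summable_choose_mul_geometric_of_norm_lt_one (Module.finrank ℂ E) hρ).mul_left
        (((1 - ‖ζ‖) ^ (Module.finrank ℂ E + 1))⁻¹ * ∫ w in ball 0 1, ‖g w‖ ∂μ))
    rw [mul_right_comm, ← integral_const_mul]
    refine setIntegral_mono_on (hint k).norm (hgi.norm.const_mul _) measurableSet_ball ?_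
    intro w hw
    rw [norm_smul, norm_smul, norm_pow, ← mul_assoc]
    refine mul_le_mul_of_nonneg_right ?_ (norm_nonneg _)
    calc ‖t‖ ^ k * ‖bergmanCoeff ζ v k w‖ ≤ ‖t‖ ^ k * _ :=
          mul_le_mul_of_nonneg_left (norm_bergmanCoeff_le v hζ (by simpa using hw) k)
            (by positivity)
      _ = _ := by
          rw [mul_div_assoc ‖t‖, mul_pow ‖t‖]
          ring
  have h := hasSum_integral_of_summable_integral_norm hint hsum
  have e : ∫ w in ball 0 1, ∑' k, t ^ k • bergmanCoeff ζ v k w • g w ∂μ =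
      μ.real (ball (0 : E) 1) • g (ζ + t • v) := by
    rw [← setIntegral_bergmanKernel_smul hz hg hgi]
    refine setIntegral_congr_fun measurableSet_ball fun w hw => ?_
    have h1 := (hasSum_bergmanCoeff (w := w) hζ (by simpa using hw) ht).smul_const (g w)
    simp only [mul_smul] at h1
    exact h1.tsum_eq
  rw [e] at h
  simpa only [integral_smul] using h

end Taylor

section TaylorBound

variable {E : Type*} [NormedAddCommGroup E] [InnerProductSpace ℂ E]

local notation "𝔫" => Module.finrank ℂ E

lemma conj_bergmanCoeff_add_smul (ζ v : E) (k : ℕ) (t : ℂ) :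
    (starRingEnd ℂ) (bergmanCoeff ζ v k (ζ + t • v)) = ((k + 𝔫).choose 𝔫 : ℂ) *
      ((inner ℂ v ζ + t * (‖v‖ ^ 2 : ℝ)) ^ k *
        ((((1 - ‖ζ‖ ^ 2 : ℝ) : ℂ) - t * inner ℂ ζ v) ^ (𝔫 + k + 1))⁻¹) := by
  simp only [bergmanCoeff, map_mul, map_pow, map_inv₀, map_sub, map_one, inner_conj_symm,
    map_natCast, inner_add_right, inner_smul_right, inner_self_eq_norm_sq_to_K]
  push_cast
  rw [show 𝔫 + 1 + k = 𝔫 + k + 1 by ring, sub_sub, mul_assoc]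
  rfl

variable [FiniteDimensional ℂ E] [MeasurableSpace E] [BorelSpace E] {μ : Measure E}
  [μ.IsAddHaarMeasure]

lemma setIntegral_bergmanCoeff_mul_conj_self {ζ : E} (v : E) (hζ : ‖ζ‖ < 1) (k : ℕ) :
    ∫ w in ball 0 1, bergmanCoeff ζ v k w * (starRingEnd ℂ) (bergmanCoeff ζ v k w) ∂μ =
      ((μ.real (ball (0 : E) 1) / (1 - ‖ζ‖ ^ 2) ^ (𝔫 + 1 + 2 * k) *
        (((k + 𝔫).choose 𝔫 : ℝ) * ∑ p ∈ Finset.HasAntidiagonal.antidiagonal k,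
          (k.choose p.1 : ℝ) * ((p.2 + (𝔫 + k)).choose (𝔫 + k)) *
            ((‖v‖ ^ 2 * (1 - ‖ζ‖ ^ 2)) ^ p.1 * (‖inner ℂ ζ v‖ ^ 2) ^ p.2)) : ℝ) : ℂ) := by
  have hS : ((1 - ‖ζ‖ ^ 2 : ℝ) : ℂ) ≠ 0 := by exact_mod_cast (one_sub_norm_sq_pos hζ).ne'
  set S : ℂ := ((1 - ‖ζ‖ ^ 2 : ℝ) : ℂ) with hSdef
  have h1 : ∀ᶠ t : ℂ in nhds 0, HasSum (fun j => t ^ j • ∫ w in ball 0 1,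
      bergmanCoeff ζ v j w • (starRingEnd ℂ) (bergmanCoeff ζ v k w) ∂μ)
      (μ.real (ball (0 : E) 1) • (starRingEnd ℂ) (bergmanCoeff ζ v k (ζ + t • v))) := by
    have : ∀ᶠ t : ℂ in nhds 0, ‖t‖ * ‖v‖ < 1 - ‖ζ‖ :=
      ContinuousAt.eventually_lt (by fun_prop) continuousAt_const (by simpa using hζ)
    filter_upwards [this] with t ht
    exact hasSum_setIntegral_bergmanCoeff_smul v hζ (differentiableOn_conj_bergmanCoeff v hζ k)
      (integrableOn_conj_bergmanCoeff v hζ k) ht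
  have h2 : ∀ᶠ t : ℂ in nhds 0, HasSum (fun j => t ^ j • ((μ.real (ball (0 : E) 1) : ℂ) *
      (((k + 𝔫).choose 𝔫 : ℂ) * ∑ p ∈ Finset.HasAntidiagonal.antidiagonal j,
        ((k.choose p.1 : ℂ) * ((p.2 + (𝔫 + k)).choose (𝔫 + k)) *
          (((‖v‖ ^ 2 : ℝ) : ℂ) ^ p.1 * inner ℂ v ζ ^ (k - p.1)) *
          (inner ℂ ζ v ^ p.2 / S ^ (𝔫 + k + 1 + p.2))))))
      (μ.real (ball (0 : E) 1) • (starRingEnd ℂ) (bergmanCoeff ζ v k (ζ + t • v))) := by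
    have : ∀ᶠ t : ℂ in nhds 0, ‖t * inner ℂ ζ v / S‖ < 1 :=
      ContinuousAt.eventually_lt (by fun_prop) continuousAt_const (by simp)
    filter_upwards [this] with t ht
    rw [conj_bergmanCoeff_add_smul, ← Complex.coe_smul, smul_eq_mul]
    refine (((hasSum_add_pow_mul_inv_sub_pow k (𝔫 + k) hS ht).mul_left _).mul_left _).congr_fun ?_
    intro j
    rw [smul_eq_mul]
    ring
  have h3 := congrFun (eq_of_eventually_hasSum_pow_smul h1 h2) k
  simp only [smul_eq_mul] at h3
  rw [h3]
  push_cast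
  have hS1 : 1 - (‖ζ‖ : ℂ) ^ 2 = S := by simp [hSdef]
  rw [hS1, div_mul_eq_mul_div, mul_div_assoc, mul_div_assoc, Finset.sum_div]
  congr 2
  refine Finset.sum_congr rfl fun p hp => ?_
  have hk := Finset.HasAntidiagonal.mem_antidiagonal.1 hp
  rw [← hk, Nat.add_sub_cancel_left, ← Complex.mul_conj', inner_conj_symm]
  simp only [mul_pow, pow_add, two_mul, pow_one]
  field_simp

lemma setIntegral_bergmanCoeff_mul_conj_zero {ζ : E} (v : E) (hζ : ‖ζ‖ < 1) (k : ℕ) :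
    ∫ w in ball 0 1, bergmanKernel ζ w * (starRingEnd ℂ) (bergmanCoeff ζ v k w) ∂μ =
      μ.real (ball (0 : E) 1) * (((k + 𝔫).choose 𝔫 : ℂ) *
        (inner ℂ v ζ ^ k / ((1 - ‖ζ‖ ^ 2 : ℝ) : ℂ) ^ (𝔫 + 1 + k))) := by
  have h := setIntegral_bergmanKernel_smul (μ := μ) hζ (differentiableOn_conj_bergmanCoeff v hζ k)
      (integrableOn_conj_bergmanCoeff v hζ k)
  have e := conj_bergmanCoeff_add_smul ζ v k 0
  simp only [zero_smul, add_zero, zero_mul, sub_zero] at e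
  simp only [smul_eq_mul] at h
  rw [h, e, ← Complex.coe_smul, smul_eq_mul, show 𝔫 + k + 1 = 𝔫 + 1 + k by ring, div_eq_mul_inv]

/-- The squared `L²` norm of the component of `bergmanCoeff ζ v k` orthogonal to
`bergmanKernel ζ`. -/
lemma setIntegral_norm_sq_bergmanCoeff_sub {ζ : E} (v : E) (hζ : ‖ζ‖ < 1) (k : ℕ) :
    ∫ w in ball 0 1, ‖bergmanCoeff ζ v k w - ((k + 𝔫).choose 𝔫 : ℂ) *
        (inner ℂ ζ v / ((1 - ‖ζ‖ ^ 2 : ℝ) : ℂ)) ^ k * bergmanKernel ζ w‖ ^ 2 ∂μ =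
      μ.real (ball (0 : E) 1) / (1 - ‖ζ‖ ^ 2) ^ (𝔫 + 1 + 2 * k) *
        (((k + 𝔫).choose 𝔫 : ℝ) * ∑ p ∈ Finset.HasAntidiagonal.antidiagonal k,
          (k.choose p.1 : ℝ) * ((p.2 + (𝔫 + k)).choose (𝔫 + k)) *
            ((‖v‖ ^ 2 * (1 - ‖ζ‖ ^ 2)) ^ p.1 * (‖inner ℂ ζ v‖ ^ 2) ^ p.2) -
          ((k + 𝔫).choose 𝔫 : ℝ) ^ 2 * (‖inner ℂ ζ v‖ ^ 2) ^ k) := by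
  have hS : ((1 - ‖ζ‖ ^ 2 : ℝ) : ℂ) ≠ 0 := by exact_mod_cast (one_sub_norm_sq_pos hζ).ne'
  have hkk := setIntegral_bergmanCoeff_mul_conj_self (μ := μ) v hζ k
  have h0k := setIntegral_bergmanCoeff_mul_conj_zero (μ := μ) v hζ k
  have h00 := setIntegral_bergmanCoeff_mul_conj_zero (μ := μ) v hζ 0
  have hk0 : ∫ w in ball 0 1, bergmanCoeff ζ v k w * (starRingEnd ℂ) (bergmanKernel ζ w) ∂μ =
      (starRingEnd ℂ) (∫ w in ball 0 1,
        bergmanKernel ζ w * (starRingEnd ℂ) (bergmanCoeff ζ v k w) ∂μ) := by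
    rw [← integral_conj]
    simp [mul_comm]
  have hint (i j : ℕ) : IntegrableOn
      (fun w => bergmanCoeff ζ v i w * (starRingEnd ℂ) (bergmanCoeff ζ v j w)) (ball 0 1) μ :=
    integrableOn_bergmanCoeff_smul v hζ i (integrableOn_conj_bergmanCoeff v hζ j)
  have ikk := hint k k
  have i0k := hint 0 k
  have ik0 := hint k 0
  have i00 := hint 0 0
  rw [h0k] at hk0
  simp only [bergmanCoeff_zero] at i0k ik0 i00 h00
  set d : ℂ := ((k + 𝔫).choose 𝔫 : ℂ) * (inner ℂ ζ v / ((1 - ‖ζ‖ ^ 2 : ℝ) : ℂ)) ^ k with hd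
  apply Complex.ofReal_injective
  rw [← integral_complex_ofReal]
  have e (w : E) : ((‖bergmanCoeff ζ v k w - d * bergmanKernel ζ w‖ ^ 2 : ℝ) : ℂ) =
      bergmanCoeff ζ v k w * (starRingEnd ℂ) (bergmanCoeff ζ v k w) -
      (starRingEnd ℂ) d * (bergmanCoeff ζ v k w * (starRingEnd ℂ) (bergmanKernel ζ w)) -
      d * (bergmanKernel ζ w * (starRingEnd ℂ) (bergmanCoeff ζ v k w)) +
      d * (starRingEnd ℂ) d * (bergmanKernel ζ w * (starRingEnd ℂ) (bergmanKernel ζ w)) := by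
    rw [Complex.ofReal_pow, ← Complex.mul_conj', map_sub, map_mul]
    ring
  simp only [e]
  have i1 : IntegrableOn (fun w =>
      bergmanCoeff ζ v k w * (starRingEnd ℂ) (bergmanCoeff ζ v k w) - (starRingEnd ℂ) d *
        (bergmanCoeff ζ v k w * (starRingEnd ℂ) (bergmanKernel ζ w))) (ball 0 1) μ :=
    ikk.sub (ik0.const_mul _)
  have i2 : IntegrableOn (fun w =>
      bergmanCoeff ζ v k w * (starRingEnd ℂ) (bergmanCoeff ζ v k w) - (starRingEnd ℂ) d *
        (bergmanCoeff ζ v k w * (starRingEnd ℂ) (bergmanKernel ζ w)) -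
        d * (bergmanKernel ζ w * (starRingEnd ℂ) (bergmanCoeff ζ v k w))) (ball 0 1) μ :=
    i1.sub (i0k.const_mul _)
  rw [integral_add i2 (i00.const_mul _), integral_sub i1 (i0k.const_mul _),
    integral_sub ikk (ik0.const_mul _), integral_const_mul, integral_const_mul,
    integral_const_mul, hkk, hk0, h0k, h00,
    mul_sub (μ.real (ball (0 : E) 1) / (1 - ‖ζ‖ ^ 2) ^ (𝔫 + 1 + 2 * k)),
    Complex.ofReal_sub (_ / _ * _), hd]
  simp only [map_mul, map_pow, map_div₀, map_natCast, Complex.conj_ofReal, inner_conj_symm]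
  have hβ : ((‖inner ℂ ζ v‖ ^ 2 : ℝ) : ℂ) = inner ℂ ζ v * inner ℂ v ζ := by
    rw [Complex.ofReal_pow, ← Complex.mul_conj', inner_conj_symm]
  have hmain : ((μ.real (ball (0 : E) 1) / (1 - ‖ζ‖ ^ 2) ^ (𝔫 + 1 + 2 * k) *
      (((k + 𝔫).choose 𝔫 : ℝ) ^ 2 * (‖inner ℂ ζ v‖ ^ 2) ^ k) : ℝ) : ℂ) =
      μ.real (ball (0 : E) 1) / ((1 - ‖ζ‖ ^ 2 : ℝ) : ℂ) ^ (𝔫 + 1 + 2 * k) *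
      (((k + 𝔫).choose 𝔫 : ℂ) ^ 2 * (inner ℂ ζ v * inner ℂ v ζ) ^ k) := by
    rw [← hβ]
    push_cast
    rfl
  rw [hmain, div_pow, div_pow, zero_add, Nat.choose_self]
  simp only [pow_zero, Nat.cast_one, add_zero, mul_pow, two_mul, pow_add _ (𝔫 + 1)]
  simp only [pow_add _ k k]
  field_simp
  ring

end TaylorBound

lemma integral_norm_mul_norm_le_sqrt_mul_sqrt {α : Type*} [MeasurableSpace α] {μ : Measure α}
    {E F : Type*} [NormedAddCommGroup E] [NormedAddCommGroup F] {f : α → E} {g : α → F}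
    (hf : MemLp f 2 μ) (hg : MemLp g 2 μ) :
    ∫ a, ‖f a‖ * ‖g a‖ ∂μ ≤ √(∫ a, ‖f a‖ ^ 2 ∂μ) * √(∫ a, ‖g a‖ ^ 2 ∂μ) := by
  have h := integral_mul_norm_le_Lp_mul_Lq (μ := μ) (f := fun a => ‖f a‖) (g := fun a => ‖g a‖)
    Real.HolderConjugate.two_two (by simpa using hf.norm) (by simpa using hg.norm)
  simpa [Real.sqrt_eq_rpow] using h

/-- First order Taylor estimate from geometric bounds on the Taylor coefficients along a complex
line. -/
lemma norm_fderiv_sub_le_of_hasSum {E F : Type*} [NormedAddCommGroup E] [NormedSpace ℂ E]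
    [NormedAddCommGroup F] [NormedSpace ℂ F] [CompleteSpace F] {g : E → F} {ζ v : E} {c : ℕ → F}
    {C u r : ℝ} (hg : DifferentiableAt ℂ g (ζ + v)) (hr1 : 1 < r) (hu0 : 0 ≤ u) (hru : r * u < 1)
    (hsum : ∀ {t : ℂ}, t ∈ ball (0 : ℂ) r → HasSum (fun k => t ^ k • c k) (g (ζ + t • v)))
    (hc0 : c 0 = 0) (hck : ∀ {k : ℕ}, 2 ≤ k → ‖c k‖ ≤ C * u ^ k) :
    ‖fderiv ℂ g (ζ + v) v - g (ζ + v)‖ ≤ C * (u ^ 2 / (1 - u) ^ 2) := by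
  have hr0 : 0 < r := by linarith
  have hu1 : u < 1 := by nlinarith
  have h1mem : (1 : ℂ) ∈ ball (0 : ℂ) r := by simpa using hr1
  have hbound : Summable fun k : ℕ => ‖(k : ℂ)‖ * r ^ (k - 1) * ‖c k‖ := by
    have hru' : ‖r * u‖ < 1 := by
      rwa [Real.norm_of_nonneg (mul_nonneg hr0.le hu0)]
    have h1 : Summable fun k : ℕ => (C / r) * ((k : ℝ) ^ 1 * (r * u) ^ k) :=
      (summable_pow_mul_geometric_of_norm_lt_one 1 hru').mul_left _
    refine Summable.of_norm_bounded_eventually_nat h1 ?_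
    filter_upwards [Filter.eventually_ge_atTop 2] with k hk
    rw [Real.norm_of_nonneg (by positivity), Complex.norm_natCast]
    refine (mul_le_mul_of_nonneg_left (hck hk) (by positivity)).trans_eq ?_
    obtain ⟨j, rfl⟩ := Nat.exists_eq_add_of_le' (one_le_two.trans hk)
    rw [Nat.add_sub_cancel, mul_pow, pow_succ r]
    field_simp
  have hterm (k : ℕ) (t : ℂ) : HasDerivAt (fun t : ℂ => t ^ k • c k)
      (((k : ℂ) * t ^ (k - 1)) • c k) t := (hasDerivAt_pow k t).smul_const (c k)
  have hder := hasDerivAt_tsum_of_isPreconnected hbound isOpen_ball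
    (convex_ball (0 : ℂ) r).isPreconnected (fun k t _ => hterm k t) (fun k t ht => by
      rw [norm_smul, norm_mul, norm_pow]
      gcongr
      exact (mem_ball_zero_iff.1 ht).le) h1mem (hsum h1mem).summable h1mem
  have hder' : HasDerivAt (fun t : ℂ => g (ζ + t • v)) (fderiv ℂ g (ζ + v) v) 1 := by
    have h1 : HasFDerivAt g (fderiv ℂ g (ζ + v)) (ζ + (1 : ℂ) • v) := by
      rw [one_smul]
      exact hg.hasFDerivAt
    have h2 : HasDerivAt (fun t : ℂ => ζ + t • v) v 1 := by
      simpa using ((hasDerivAt_id (1 : ℂ)).smul_const v).const_add ζ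
    exact h1.comp_hasDerivAt 1 h2
  have heq : fderiv ℂ g (ζ + v) v = ∑' k : ℕ, ((k : ℂ) * 1 ^ (k - 1)) • c k := by
    refine hder'.unique (hder.congr_of_eventuallyEq ?_)
    filter_upwards [isOpen_ball.mem_nhds h1mem] with t ht
    exact (hsum ht).tsum_eq.symm
  have hd : HasSum (fun k : ℕ => (k : ℂ) • c k) (fderiv ℂ g (ζ + v) v) := by
    rw [heq]
    simp only [one_pow, mul_one]
    refine (Summable.of_norm_bounded hbound fun k => ?_).hasSum
    rw [norm_smul]
    refine mul_le_mul_of_nonneg_right (le_mul_of_one_le_right (norm_nonneg _) ?_) (norm_nonneg _)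
    exact one_le_pow₀ hr1.le
  have hs : HasSum c (g (ζ + v)) := by simpa using hsum h1mem
  have hdiff : HasSum (fun k : ℕ => (k : ℂ) • c (k + 1)) (fderiv ℂ g (ζ + v) v - g (ζ + v)) := by
    have h := (hasSum_nat_add_iff' 1).2 (hd.sub hs)
    simpa [hc0, add_smul] using h
  have hgeom := (hasSum_coe_mul_geometric_of_norm_lt_one
    (by rwa [Real.norm_of_nonneg hu0] : ‖u‖ < 1)).mul_left (C * u)
  refine (hdiff.norm_le_of_bounded hgeom fun k => ?_).trans_eq (by ring)
  rw [norm_smul, Complex.norm_natCast]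
  rcases k.eq_zero_or_pos with rfl | hk
  · simp
  · refine (mul_le_mul_of_nonneg_left (hck (by lia : 2 ≤ k + 1)) (by positivity)).trans_eq ?_
    ring

section CauchyEstimate

variable {E : Type*} [NormedAddCommGroup E] [InnerProductSpace ℂ E] [FiniteDimensional ℂ E]
  [MeasurableSpace E] [BorelSpace E] {μ : Measure E}
  {F : Type*} [NormedAddCommGroup F] [NormedSpace ℂ F]

lemma memLp_two_ball_of_differentiableOn {g : E → F} (hg : DifferentiableOn ℂ g (ball 0 1))
    (hg2 : IntegrableOn (fun w => ‖g w‖ ^ 2) (ball 0 1) μ) :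
    MemLp g 2 (μ.restrict (ball 0 1)) :=
  (memLp_two_iff_integrable_sq_norm
    (hg.continuousOn.aestronglyMeasurable measurableSet_ball)).2 hg2

variable [μ.IsAddHaarMeasure]

lemma integrableOn_ball_of_differentiableOn {g : E → F} (hg : DifferentiableOn ℂ g (ball 0 1))
    (hg2 : IntegrableOn (fun w => ‖g w‖ ^ 2) (ball 0 1) μ) : IntegrableOn g (ball 0 1) μ := by
  have : IsFiniteMeasure (μ.restrict (ball (0 : E) 1)) :=
    ⟨by simpa using measure_ball_lt_top⟩
  exact (memLp_two_ball_of_differentiableOn hg hg2).integrable one_le_two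

lemma memLp_two_bergmanCoeff {ζ : E} (v : E) (hζ : ‖ζ‖ < 1) (k : ℕ) :
    MemLp (bergmanCoeff ζ v k) 2 (μ.restrict (ball 0 1)) := by
  have : IsFiniteMeasure (μ.restrict (ball (0 : E) 1)) :=
    ⟨by simpa using measure_ball_lt_top⟩
  refine MemLp.of_bound
    ((continuousOn_bergmanCoeff v hζ k).aestronglyMeasurable measurableSet_ball)
    (((1 - ‖ζ‖) ^ (Module.finrank ℂ E + 1))⁻¹ *
      (((k + Module.finrank ℂ E).choose (Module.finrank ℂ E) : ℝ) * (‖v‖ / (1 - ‖ζ‖)) ^ k)) ?_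
  filter_upwards [ae_restrict_mem measurableSet_ball] with w hw
  exact norm_bergmanCoeff_le v hζ (by simpa using hw) k

variable [CompleteSpace F]

/-- Cauchy type estimate, with sharp dependence on `ζ`, for the Taylor coefficients of a square
integrable holomorphic function on the unit ball vanishing at `ζ`. -/
theorem norm_setIntegral_bergmanCoeff_smul_le {g : E → F} {ζ : E} (v : E) (hζ : ‖ζ‖ < 1)
    (hg : DifferentiableOn ℂ g (ball 0 1))
    (hg2 : IntegrableOn (fun w => ‖g w‖ ^ 2) (ball 0 1) μ) (hgζ : g ζ = 0)
    (hn : 2 ≤ Module.finrank ℂ E) {k : ℕ} (hk : 2 ≤ k) :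
    ‖∫ w in ball 0 1, bergmanCoeff ζ v k w • g w ∂μ‖ ≤
      √(μ.real (ball (0 : E) 1) / (1 - ‖ζ‖ ^ 2) ^ (Module.finrank ℂ E + 1)) *
        √(∫ w in ball 0 1, ‖g w‖ ^ 2 ∂μ) *
        ((Module.finrank ℂ E + 1) * ‖v‖ / (1 - ‖ζ‖ ^ 2)) ^ k := by
  have hS := one_sub_norm_sq_pos hζ
  have hgi := integrableOn_ball_of_differentiableOn hg hg2
  set d : ℂ := ((k + Module.finrank ℂ E).choose (Module.finrank ℂ E) : ℂ) *
    (inner ℂ ζ v / ((1 - ‖ζ‖ ^ 2 : ℝ) : ℂ)) ^ k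
  have hQ : MemLp (fun w => bergmanCoeff ζ v k w - d * bergmanKernel ζ w) 2
      (μ.restrict (ball 0 1)) := by
    rw [← bergmanCoeff_zero ζ v]
    exact (memLp_two_bergmanCoeff v hζ k).sub ((memLp_two_bergmanCoeff v hζ 0).const_mul d)
  have h1 : ∫ w in ball 0 1, bergmanCoeff ζ v k w • g w ∂μ =
      ∫ w in ball 0 1, (bergmanCoeff ζ v k w - d * bergmanKernel ζ w) • g w ∂μ := by
    have h2 := setIntegral_bergmanKernel_smul hζ hg hgi
    simp only [sub_smul, mul_smul]
    have h4 : IntegrableOn (fun w => d • bergmanKernel ζ w • g w) (ball 0 1) μ :=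
      (integrableOn_bergmanKernel_smul hζ hgi).smul d
    rw [integral_sub (integrableOn_bergmanCoeff_smul v hζ k hgi) h4, integral_smul, h2, hgζ]
    simp
  have h3 : ∫ w in ball 0 1, ‖bergmanCoeff ζ v k w - d * bergmanKernel ζ w‖ ^ 2 ∂μ ≤
      μ.real (ball (0 : E) 1) / (1 - ‖ζ‖ ^ 2) ^ (Module.finrank ℂ E + 1) *
        (((Module.finrank ℂ E + 1) * ‖v‖ / (1 - ‖ζ‖ ^ 2)) ^ k) ^ 2 := by
    rw [setIntegral_norm_sq_bergmanCoeff_sub v hζ k]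
    have hin : ‖inner ℂ ζ v‖ ^ 2 ≤ (‖ζ‖ * ‖v‖) ^ 2 := by
      gcongr
      exact norm_inner_le_norm ζ v
    calc _ ≤ μ.real (ball (0 : E) 1) / (1 - ‖ζ‖ ^ 2) ^ (Module.finrank ℂ E + 1 + 2 * k) *
          ((((Module.finrank ℂ E : ℝ) + 1) ^ k) ^ 2 * (‖v‖ ^ 2) ^ k) := by
          gcongr
          exact choose_mul_sum_sub_le hn hk (by positivity) (by positivity) (by linarith)
      _ = _ := by
          rw [pow_add, div_pow, div_pow, mul_pow, mul_pow]
          field_simp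
          ring
  rw [h1]
  calc _ ≤ ∫ w in ball 0 1, ‖bergmanCoeff ζ v k w - d * bergmanKernel ζ w‖ * ‖g w‖ ∂μ := by
        refine (norm_integral_le_integral_norm _).trans_eq ?_
        simp only [norm_smul]
    _ ≤ √(∫ w in ball 0 1, ‖bergmanCoeff ζ v k w - d * bergmanKernel ζ w‖ ^ 2 ∂μ) *
        √(∫ w in ball 0 1, ‖g w‖ ^ 2 ∂μ) :=
        integral_norm_mul_norm_le_sqrt_mul_sqrt hQ (memLp_two_ball_of_differentiableOn hg hg2)
    _ ≤ _ := by
        rw [mul_right_comm]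
        gcongr
        refine (Real.sqrt_le_sqrt h3).trans_eq ?_
        rw [Real.sqrt_mul (by positivity), Real.sqrt_sq (by positivity)]

/-- First order Taylor estimate at a zero `ζ` of a square integrable holomorphic function on the
unit ball. -/
theorem norm_fderiv_sub_le_of_unit_ball {g : E → F} {ζ v : E} (hζ : ‖ζ‖ < 1)
    (hg : DifferentiableOn ℂ g (ball 0 1))
    (hg2 : IntegrableOn (fun w => ‖g w‖ ^ 2) (ball 0 1) μ) (hgζ : g ζ = 0)
    (hn : 2 ≤ Module.finrank ℂ E) {u : ℝ}
    (hu : (Module.finrank ℂ E + 1) * ‖v‖ / (1 - ‖ζ‖ ^ 2) = u) (hu1 : u < 1) :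
    ‖fderiv ℂ g (ζ + v) v - g (ζ + v)‖ ≤
      √((μ.real (ball (0 : E) 1))⁻¹ * ∫ w in ball 0 1, ‖g w‖ ^ 2 ∂μ) /
        √((1 - ‖ζ‖ ^ 2) ^ (Module.finrank ℂ E + 1)) * (u ^ 2 / (1 - u) ^ 2) := by
  have hS := one_sub_norm_sq_pos hζ
  have hgi := integrableOn_ball_of_differentiableOn hg hg2
  have hm : 0 < μ.real (ball (0 : E) 1) :=
    ENNReal.toReal_pos (measure_ball_pos μ 0 one_pos).ne' measure_ball_lt_top.ne
  have hu0 : 0 ≤ u := by rw [← hu]; positivity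
  set C : ℝ := √((μ.real (ball (0 : E) 1))⁻¹ * ∫ w in ball 0 1, ‖g w‖ ^ 2 ∂μ) /
    √((1 - ‖ζ‖ ^ 2) ^ (Module.finrank ℂ E + 1)) with hC
  set c : ℕ → F := fun k =>
    (μ.real (ball (0 : E) 1))⁻¹ • ∫ w in ball 0 1, bergmanCoeff ζ v k w • g w ∂μ with hc
  have hsum {t : ℂ} (ht : ‖t‖ * ‖v‖ < 1 - ‖ζ‖) :
      HasSum (fun k => t ^ k • c k) (g (ζ + t • v)) := by
    have h := (hasSum_setIntegral_bergmanCoeff_smul v hζ hg hgi ht).const_smul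
      (μ.real (ball (0 : E) 1))⁻¹
    rw [inv_smul_smul₀ hm.ne'] at h
    exact h.congr_fun fun k => smul_comm _ _ _
  have hc0 : c 0 = 0 := by
    simp only [hc, bergmanCoeff_zero, setIntegral_bergmanKernel_smul hζ hg hgi, hgζ, smul_zero]
  have hck {k : ℕ} (hk : 2 ≤ k) : ‖c k‖ ≤ C * u ^ k := by
    have h := norm_setIntegral_bergmanCoeff_smul_le v hζ hg hg2 hgζ hn hk
    rw [hu] at h
    rw [hc, norm_smul, Real.norm_of_nonneg (by positivity)]
    refine (mul_le_mul_of_nonneg_left h (by positivity)).trans_eq ?_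
    rw [hC, Real.sqrt_div hm.le, Real.sqrt_mul (by positivity), Real.sqrt_inv]
    have : √(μ.real (ball (0 : E) 1)) ≠ 0 := by positivity
    have h2 := Real.sq_sqrt hm.le
    nth_rw 1 [← h2]
    field_simp
  obtain ⟨r, hr1, hru⟩ : ∃ r : ℝ, 1 < r ∧ r * u < 1 := by
    refine ⟨2 / (1 + u), ?_, ?_⟩
    · rw [lt_div_iff₀ (by positivity)]
      linarith
    · rw [div_mul_eq_mul_div, div_lt_one (by positivity)]
      linarith
  have hr0 : 0 < r := by linarith
  have hrv : r * ‖v‖ < 1 - ‖ζ‖ := by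
    have h1 : 3 * (r * ‖v‖) < 1 - ‖ζ‖ ^ 2 := by
      have h2 : (3 : ℝ) ≤ (Module.finrank ℂ E : ℝ) + 1 := by
        have : (2 : ℝ) ≤ (Module.finrank ℂ E : ℝ) := by exact_mod_cast hn
        linarith
      calc 3 * (r * ‖v‖) ≤ ((Module.finrank ℂ E : ℝ) + 1) * (r * ‖v‖) := by gcongr
        _ = r * u * (1 - ‖ζ‖ ^ 2) := by
          rw [← hu]
          field_simp
        _ < 1 * (1 - ‖ζ‖ ^ 2) := by gcongr
        _ = _ := one_mul _
    nlinarith [norm_nonneg ζ]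
  have hball {t : ℂ} (ht : t ∈ ball (0 : ℂ) r) : ‖t‖ * ‖v‖ < 1 - ‖ζ‖ := by
    rw [mem_ball_zero_iff] at ht
    exact (mul_le_mul_of_nonneg_right ht.le (norm_nonneg v)).trans_lt hrv
  refine norm_fderiv_sub_le_of_hasSum ?_ hr1 hu0 hru (fun ht => hsum (hball ht)) hc0 hck
  refine hg.differentiableAt (isOpen_ball.mem_nhds ?_)
  have h1 := hball (t := 1) (by simpa using hr1)
  rw [norm_one, one_mul] at h1
  rw [mem_ball_zero_iff]
  linarith [norm_add_le ζ v]

end CauchyEstimate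

section Rescaling

variable {E : Type*} [NormedAddCommGroup E] [InnerProductSpace ℂ E]

lemma add_smul_image_ball (ω : E) {R : ℝ} (hR : 0 < R) :
    (fun z : E => ω + (R : ℂ) • z) '' ball 0 1 = ball ω R := by
  have hR' : (R : ℂ) ≠ 0 := by exact_mod_cast hR.ne'
  ext x
  simp only [Set.mem_image, mem_ball_iff_norm, sub_zero]
  constructor
  · rintro ⟨z, hz, rfl⟩
    rw [add_sub_cancel_left, norm_smul, Complex.norm_real, Real.norm_of_nonneg hR.le]
    nlinarith
  · intro hx
    refine ⟨(R : ℂ)⁻¹ • (x - ω), ?_, ?_⟩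
    · rwa [norm_smul, norm_inv, Complex.norm_real, Real.norm_of_nonneg hR.le,
        inv_mul_lt_iff₀ hR, mul_one]
    · rw [smul_inv_smul₀ hR', add_sub_cancel]

lemma add_smul_injective (ω : E) {R : ℝ} (hR : 0 < R) :
    Function.Injective (fun z : E => ω + (R : ℂ) • z) :=
  (add_right_injective ω).comp (smul_right_injective E (by exact_mod_cast hR.ne' : (R : ℂ) ≠ 0))

lemma hasFDerivAt_add_smul (ω : E) (R : ℂ) (z : E) :
    HasFDerivAt (fun z : E => ω + R • z) (R • ContinuousLinearMap.id ℂ E) z :=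
  ((hasFDerivAt_id z).const_smul R).const_add ω

variable [FiniteDimensional ℂ E]

lemma abs_det_smul_id {R : ℝ} (hR : 0 < R) :
    |(((R : ℂ) • ContinuousLinearMap.id ℂ E).restrictScalars ℝ : E →L[ℝ] E).det| =
      R ^ (2 * Module.finrank ℂ E) := by
  rw [abs_det_restrictScalars]
  have h : (((R : ℂ) • ContinuousLinearMap.id ℂ E : E →L[ℂ] E) : E →ₗ[ℂ] E) =
    (R : ℂ) • LinearMap.id := rfl
  rw [h, LinearMap.det_smul, LinearMap.det_id, mul_one, norm_pow, Complex.norm_real,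
    Real.norm_of_nonneg hR.le, ← pow_mul, mul_comm]

variable [MeasurableSpace E] [BorelSpace E] {μ : Measure E} [μ.IsAddHaarMeasure]

lemma setIntegral_ball_eq_mul (h : E → ℝ) (ω : E) {R : ℝ} (hR : 0 < R) :
    ∫ z in ball ω R, h z ∂μ =
      R ^ (2 * Module.finrank ℂ E) * ∫ z in ball 0 1, h (ω + (R : ℂ) • z) ∂μ := by
  rw [← add_smul_image_ball ω hR, integral_image_eq_integral_abs_det_fderiv_smul μ
    measurableSet_ball (fun z _ =>
      ((hasFDerivAt_add_smul ω R z).restrictScalars ℝ).hasFDerivWithinAt)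
    (add_smul_injective ω hR).injOn, abs_det_smul_id hR]
  exact integral_const_mul _ _

lemma integrableOn_comp_add_smul {h : E → ℝ} {ω : E} {R : ℝ} (hR : 0 < R)
    (hh : IntegrableOn h (ball ω R) μ) :
    IntegrableOn (fun z => h (ω + (R : ℂ) • z)) (ball 0 1) μ := by
  rw [← add_smul_image_ball ω hR, integrableOn_image_iff_integrableOn_abs_det_fderiv_smul μ
    measurableSet_ball (fun z _ =>
      ((hasFDerivAt_add_smul ω R z).restrictScalars ℝ).hasFDerivWithinAt)
    (add_smul_injective ω hR).injOn, abs_det_smul_id hR] at hh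
  exact (integrable_smul_iff (pow_pos hR _).ne' _).1 hh

variable {F : Type*} [NormedAddCommGroup F] [NormedSpace ℂ F] [CompleteSpace F]

/-- First order Taylor estimate at a zero `ζ` of a square integrable holomorphic function on
a ball. -/
theorem norm_fderiv_sub_le_of_ball {f : E → F} {ω ζ x : E} {R : ℝ} (hR : 0 < R)
    (hζ : ζ ∈ ball ω R) (hx : x ∈ ball ω R) (hf : DifferentiableOn ℂ f (ball ω R))
    (hf2 : IntegrableOn (fun z => ‖f z‖ ^ 2) (ball ω R) μ) (hfζ : f ζ = 0)
    (hn : 2 ≤ Module.finrank ℂ E) {u : ℝ}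
    (hu : (Module.finrank ℂ E + 1) / (R * (1 - (‖ζ - ω‖ / R) ^ 2)) * ‖x - ζ‖ = u)
    (hu1 : u < 1) :
    ‖fderiv ℂ f x (x - ζ) - f x‖ ≤
      √((μ.real (ball (0 : E) 1) * R ^ (2 * Module.finrank ℂ E))⁻¹ *
          ∫ z in ball ω R, ‖f z‖ ^ 2 ∂μ) /
        √((1 - (‖ζ - ω‖ / R) ^ 2) ^ (Module.finrank ℂ E + 1)) * (u ^ 2 / (1 - u) ^ 2) := by
  have hR' : (R : ℂ) ≠ 0 := by exact_mod_cast hR.ne'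
  have hnorm (y : E) : ‖(R : ℂ)⁻¹ • y‖ = ‖y‖ / R := by
    rw [norm_smul, norm_inv, Complex.norm_real, Real.norm_of_nonneg hR.le, inv_mul_eq_div]
  have hback (y : E) : ω + (R : ℂ) • (R : ℂ)⁻¹ • (y - ω) = y := by
    rw [smul_inv_smul₀ hR', add_sub_cancel]
  have hadd : (R : ℂ)⁻¹ • (ζ - ω) + (R : ℂ)⁻¹ • (x - ζ) = (R : ℂ)⁻¹ • (x - ω) := by
    rw [← smul_add]
    congr 1
    abel
  have hmaps : Set.MapsTo (fun z : E => ω + (R : ℂ) • z) (ball 0 1) (ball ω R) := by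
    rw [← add_smul_image_ball ω hR]
    exact Set.mapsTo_image _ _
  have hζ' : ‖(R : ℂ)⁻¹ • (ζ - ω)‖ < 1 := by
    rw [hnorm, div_lt_one hR]
    rwa [mem_ball_iff_norm] at hζ
  have hder : fderiv ℂ (fun z => f (ω + (R : ℂ) • z))
      ((R : ℂ)⁻¹ • (ζ - ω) + (R : ℂ)⁻¹ • (x - ζ)) ((R : ℂ)⁻¹ • (x - ζ)) =
      fderiv ℂ f x (x - ζ) := by
    rw [hadd]
    have h1 : HasFDerivAt f (fderiv ℂ f x) (ω + (R : ℂ) • (R : ℂ)⁻¹ • (x - ω)) := by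
      rw [hback]
      exact (hf.differentiableAt (isOpen_ball.mem_nhds hx)).hasFDerivAt
    have h2 : HasFDerivAt (fun z => f (ω + (R : ℂ) • z)) _ ((R : ℂ)⁻¹ • (x - ω)) :=
      HasFDerivAt.comp (f := fun z => ω + (R : ℂ) • z) _ h1 (hasFDerivAt_add_smul ω (R : ℂ) _)
    rw [h2.fderiv]
    rw [ContinuousLinearMap.comp_apply, smul_apply, ContinuousLinearMap.id_apply,
      smul_inv_smul₀ hR']
  have h := norm_fderiv_sub_le_of_unit_ball (μ := μ) (g := fun z => f (ω + (R : ℂ) • z))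
    (v := (R : ℂ)⁻¹ • (x - ζ)) (u := u) hζ'
    (hf.comp (fun z _ => (hasFDerivAt_add_smul ω (R : ℂ) z).differentiableAt.differentiableWithinAt)
      hmaps) (integrableOn_comp_add_smul hR hf2) (by rw [hback, hfζ]) hn
    (by rw [hnorm, hnorm, ← hu]; field_simp) hu1
  rw [hder, hnorm, hadd, hback] at h
  rw [setIntegral_ball_eq_mul _ ω hR]
  convert h using 4
  field_simp

end Rescaling

lemma volume_real_ball_En (n : ℕ) (hn : 1 ≤ n) :
    volume.real (ball (0 : En n) 1) = Real.pi ^ n / n.factorial := by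
  have : Nontrivial (En n) := Module.nontrivial_of_finrank_pos (R := ℂ)
    (by rw [finrank_euclideanSpace_fin]; exact hn)
  have hdim : Module.finrank ℝ (En n) = 2 * n := by
    have := finrank_real_of_complex (En n)
    simpa using this
  rw [Measure.real, InnerProductSpace.volume_ball_of_dim_even hdim]
  simp [ENNReal.toReal_ofReal (by positivity : 0 ≤ Real.pi ^ n / n.factorial)]

lemma A2Norm_eq_sqrt {𝓕 : Type*} [NormedAddCommGroup 𝓕] {n : ℕ} (hn : 1 ≤ n) (ω : En n) (R : ℝ)
    (f : En n → 𝓕) :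
    A2Norm ω R f = √((volume.real (ball (0 : En n) 1) * R ^ (2 * n))⁻¹ *
      ∫ z in ball ω R, ‖f z‖ ^ 2) := by
  rw [A2Norm, volume_real_ball_En n hn, div_mul_eq_mul_div (Real.pi ^ n), inv_div]

/-- Let `ζ ∈ B(ω,R)` be a zero of `f = (f₁,…,f_n) ∈ A²(ω,R)^n` with `Df(ζ)` invertible;
write `γ = γ(f,ζ)`, `κ = κ_ζ`, and for `x ∈ B(ω,R)` set `u = κ‖x−ζ‖`.  If `u < 1`, then
`‖Df(ζ)⁻¹ (Df(x)(x−ζ) − f(x))‖ ≤ γu²/(1−u)²`. -/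
theorem stmt14 (n : ℕ) (hn : 2 ≤ n) (ω : En n) (R : ℝ) (hR : 0 < R)
    (f : En n → En n) (hf : MemA2 ω R f)
    (ζ : En n) (hζ : ζ ∈ ball ω R) (hfζ : f ζ = 0)
    (A : En n ≃L[ℂ] En n) (hA : (A : En n →L[ℂ] En n) = fderiv ℂ f ζ) :
    let ν : ℝ := ‖ζ - ω‖ / R
    let κ : ℝ := max 1 (((n : ℝ) + 1) / (R * (1 - ν ^ 2)))
    let lam : ℝ := A2Norm ω R f / (1 - ν ^ 2) ^ (((n : ℝ) + 1) / 2)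
    let γ : ℝ := max 1 (lam * κ * ‖(A.symm : En n →L[ℂ] En n)‖)
    ∀ x ∈ ball ω R,
      κ * ‖x - ζ‖ < 1 →
      ‖A.symm (fderiv ℂ f x (x - ζ) - f x)‖ ≤
        γ * (κ * ‖x - ζ‖) ^ 2 / (1 - κ * ‖x - ζ‖) ^ 2 := by
  intro ν κ lam γ x hx hu
  have hν : ν < 1 := by
    rw [div_lt_one hR]
    rwa [mem_ball_iff_norm] at hζ
  have hν0 : 0 ≤ ν := by positivity
  have hS : 0 < 1 - ν ^ 2 := by nlinarith
  have hκ1 : 1 ≤ κ := le_max_left _ _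
  have hlam : 0 ≤ lam := div_nonneg (Real.sqrt_nonneg _) (Real.rpow_nonneg hS.le _)
  set u' : ℝ := ((n : ℝ) + 1) / (R * (1 - ν ^ 2)) * ‖x - ζ‖ with hu'
  have hle : u' ≤ κ * ‖x - ζ‖ :=
    mul_le_mul_of_nonneg_right (le_max_right _ _) (norm_nonneg _)
  have hu'0 : 0 ≤ u' := by positivity
  have hmain := norm_fderiv_sub_le_of_ball (μ := volume) (u := u') hR hζ hx
    hf.1.differentiableOn hf.2 hfζ (by simpa using hn) (by rw [hu']; simp [ν]) (hle.trans_lt hu)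
  have hN : √((volume.real (ball (0 : En n) 1) * R ^ (2 * Module.finrank ℂ (En n)))⁻¹ *
      ∫ z in ball ω R, ‖f z‖ ^ 2) / √((1 - ν ^ 2) ^ (Module.finrank ℂ (En n) + 1)) = lam := by
    rw [finrank_euclideanSpace_fin, ← A2Norm_eq_sqrt (one_le_two.trans hn),
      Real.sqrt_eq_rpow, ← Real.rpow_natCast, ← Real.rpow_mul hS.le]
    simp only [lam]
    congr 2
    push_cast
    ring
  rw [hN] at hmain
  have hu1 : 0 < 1 - κ * ‖x - ζ‖ := by linarith
  calc ‖A.symm (fderiv ℂ f x (x - ζ) - f x)‖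
      ≤ ‖(A.symm : En n →L[ℂ] En n)‖ * ‖fderiv ℂ f x (x - ζ) - f x‖ :=
        (A.symm : En n →L[ℂ] En n).le_opNorm _
    _ ≤ ‖(A.symm : En n →L[ℂ] En n)‖ * (lam * ((κ * ‖x - ζ‖) ^ 2 / (1 - κ * ‖x - ζ‖) ^ 2)) := by
        refine mul_le_mul_of_nonneg_left (hmain.trans ?_) (norm_nonneg _)
        gcongr
    _ = lam * 1 * ‖(A.symm : En n →L[ℂ] En n)‖ *
        ((κ * ‖x - ζ‖) ^ 2 / (1 - κ * ‖x - ζ‖) ^ 2) := by ring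
    _ ≤ γ * ((κ * ‖x - ζ‖) ^ 2 / (1 - κ * ‖x - ζ‖) ^ 2) := by
        refine mul_le_mul_of_nonneg_right (le_trans ?_ (le_max_right _ _)) (by positivity)
        gcongr
    _ = _ := by rw [mul_div_assoc]
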